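/- Every (0,1,β,Ω)-Euler data Q automatically satisfies the self-linking condition: for all d ≥ 1, all 0 ≤ i ≤ n, all j ≠ i and all k ≥ 0, the polynomials Q_{d,k}(λ_i) and β(λ_j)^k · Q_{d,0}(λ_i) in F[ℏ] agree after the substitution ℏ := (λ_i − λ_j)/d. -/

import Mathlib

open Polynomial

set_option maxHeartbeats 1000000
set_option synthInstance.maxHeartbeats 400000

noncomputable section

/-- The ground field `F = ℂ(λ₀,…,λₙ)`, the field of rational functions in the
equivariant weights `λ₀,…,λₙ`. -/
def F (n : ℕ) : Type := FractionRing (MvPolynomial (Fin (n+1)) ℂ)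

instance (n : ℕ) : Field (F n) :=
  inferInstanceAs (Field (FractionRing (MvPolynomial (Fin (n+1)) ℂ)))

instance (n : ℕ) : Algebra (MvPolynomial (Fin (n+1)) ℂ) (F n) :=
  inferInstanceAs (Algebra (MvPolynomial (Fin (n+1)) ℂ)
    (FractionRing (MvPolynomial (Fin (n+1)) ℂ)))

/-- The weight `λᵢ` as an element of `F`. -/
def lam (n : ℕ) (i : Fin (n+1)) : F n :=
  algebraMap (MvPolynomial (Fin (n+1)) ℂ) (F n) (MvPolynomial.X i)

/-- The polynomial ring `F[ℏ]`.  The variable `X` plays the role of `ℏ`. -/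
abbrev Fh (n : ℕ) : Type := Polynomial (F n)

/-- The element `λᵢ + rℏ` of `F[ℏ]`. -/
def pt (n : ℕ) (i : Fin (n+1)) (r : ℕ) : Fh n := C (lam n i) + (r : Fh n) * X

/-- The generator `∏_{l=0}^{n} ∏_{m=0}^{d} (κ − λ_l − mℏ)` of the relation ideal
of the localized equivariant cohomology of `N_d`; the outer polynomial
variable `X` plays the role of `κ`. -/
def genN (n d : ℕ) : Polynomial (Fh n) :=
  ∏ l : Fin (n+1), ∏ m ∈ Finset.range (d+1), (X - C (pt n l m))

/-- Classes on the linear model `N_d`: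
`F[ℏ][κ] / (∏_{l=0}^{n} ∏_{m=0}^{d} (κ − λ_l − mℏ))`. -/
abbrev ClassN (n d : ℕ) : Type :=
  Polynomial (Fh n) ⧸ Ideal.span {genN n d}

lemma eval_genN (n d : ℕ) (i : Fin (n+1)) (r : ℕ) (hr : r ≤ d) :
    Polynomial.eval (pt n i r) (genN n d) = 0 := by
  rw [genN, Polynomial.eval_prod]
  refine Finset.prod_eq_zero (Finset.mem_univ i) ?_
  rw [Polynomial.eval_prod]
  refine Finset.prod_eq_zero (Finset.mem_range.mpr (Nat.lt_succ_of_le hr)) ?_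
  simp

/-- Restriction `Q(λᵢ + rℏ) ∈ F[ℏ]` of a class `Q` on `N_d` (for `r ≤ d`):
evaluation of any representative at `κ = λᵢ + rℏ`. -/
def rest {n d : ℕ} (i : Fin (n+1)) (r : ℕ) (hr : r ≤ d) : ClassN n d →+* Fh n :=
  Ideal.Quotient.lift _ (Polynomial.evalRingHom (pt n i r)) (by
    intro a ha
    rw [Ideal.mem_span_singleton] at ha
    obtain ⟨c, rfl⟩ := ha
    simp [eval_genN n d i r hr])

/-- `Ω`-Euler data, where the invertible class `Ω` on `ℙⁿ` is identified with the family
of its restrictions `Ω(λᵢ) ∈ F` (the weights `λᵢ` being pairwise distinct, a class on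
`ℙⁿ` is precisely such a family). -/
def IsEulerData {n : ℕ} (Ω : Fin (n+1) → F n) (Q : (d : ℕ) → ClassN n d) : Prop :=
  (∀ i, rest i 0 le_rfl (Q 0) = C (Ω i)) ∧
  ∀ d r, 0 < r → ∀ hr : r < d, ∀ i : Fin (n+1),
    C (Ω i) * rest i r hr.le (Q d) =
      rest i r le_rfl (Q r) * rest i 0 (Nat.zero_le _) (Q (d - r))

/-- `(0,1,β,Ω)`-Euler data; the classes `β`, `Ω` on `ℙⁿ` are identified with the
families of their restrictions at the fixed points. -/
def Is01EulerData {n : ℕ} (β Ω : Fin (n+1) → F n) (Q : (d : ℕ) → ℕ → ClassN n d) : Prop :=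
  (∀ (k : ℕ) i, rest i 0 le_rfl (Q 0 k) = C (β i ^ k * Ω i)) ∧
  ∀ d, 1 ≤ d → ∀ r, ∀ hr : r ≤ d, ∀ i : Fin (n+1), ∀ k : ℕ,
    C (Ω i) * rest i r hr (Q d k) =
      rest i r le_rfl (Q r 0) * rest i 0 (Nat.zero_le _) (Q (d - r) k)

end

instance (n : ℕ) : CharZero (F n) :=
  haveI : CharZero (MvPolynomial (Fin (n + 1)) ℂ) :=
    charZero_of_injective_algebraMap (MvPolynomial.C_injective (Fin (n + 1)) ℂ)
  charZero_of_injective_algebraMap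
    (IsFractionRing.injective (MvPolynomial (Fin (n + 1)) ℂ)
      (FractionRing (MvPolynomial (Fin (n + 1)) ℂ)))

/-- Two restrictions of a class agree at any value of `ℏ` where their base points coincide. -/
lemma eval_rest_eq_of_eval_pt_eq {n d : ℕ} {i j : Fin (n + 1)} {r s : ℕ} (hr : r ≤ d)
    (hs : s ≤ d) {x : F n} (h : eval x (pt n i r) = eval x (pt n j s)) (q : ClassN n d) :
    eval x (rest i r hr q) = eval x (rest j s hs q) := by
  obtain ⟨p, rfl⟩ := Ideal.Quotient.mk_surjective q
  change evalRingHom x (eval (pt n i r) p) = evalRingHom x (eval (pt n j s) p)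
  rw [← eval₂_at_apply, ← eval₂_at_apply, coe_evalRingHom, h]

/-- The Euler condition at the top fixed point `r = d` determines `Q_{d,k}` from `Q_{d,0}`. -/
lemma Is01EulerData.rest_top {n : ℕ} {β Ω : Fin (n + 1) → F n}
    {Q : (d : ℕ) → ℕ → ClassN n d} (hQ : Is01EulerData β Ω Q) {d : ℕ} (hd : 1 ≤ d)
    {j : Fin (n + 1)} (hΩ : Ω j ≠ 0) (k : ℕ) :
    rest j d le_rfl (Q d k) = C (β j ^ k) * rest j d le_rfl (Q d 0) := by
  have hzero : ∀ m, m = 0 → rest j 0 (Nat.zero_le m) (Q m k) = C (β j ^ k * Ω j) := by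
    rintro _ rfl
    exact hQ.1 k j
  have h := hQ.2 d hd d le_rfl j k
  rw [hzero (d - d) (Nat.sub_self d), C_mul] at h
  refine mul_left_cancel₀ (C_ne_zero.mpr hΩ) ?_
  rw [h]
  ring

/-- **Self-linking condition**: any `(0,1,β,Ω)`-Euler data `Q` satisfies
`Q_{d,k}(λᵢ) = β(λⱼ)^k · Q_{d,0}(λᵢ)` at `ℏ = (λᵢ − λⱼ)/d`. -/
theorem self_linking_01_euler_data (n : ℕ) (hn : 1 ≤ n)
    (β Ω : Fin (n+1) → F n) (hΩ : ∀ i, Ω i ≠ 0)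
    (Q : (d : ℕ) → ℕ → ClassN n d) (hQ : Is01EulerData β Ω Q) :
    ∀ d : ℕ, 1 ≤ d → ∀ i j : Fin (n+1), j ≠ i → ∀ k : ℕ,
      Polynomial.eval ((lam n i - lam n j) / (d : F n))
          (rest i 0 (Nat.zero_le d) (Q d k)) =
        β j ^ k *
          Polynomial.eval ((lam n i - lam n j) / (d : F n))
            (rest i 0 (Nat.zero_le d) (Q d 0)) := by
  intro d hd i j _ k
  have hd0 : (d : F n) ≠ 0 := Nat.cast_ne_zero.mpr (by omega)
  have hpt : eval ((lam n i - lam n j) / (d : F n)) (pt n i 0) =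
      eval ((lam n i - lam n j) / (d : F n)) (pt n j d) := by
    simp [pt, mul_div_cancel₀ _ hd0]
  rw [eval_rest_eq_of_eval_pt_eq (Nat.zero_le d) le_rfl hpt,
    eval_rest_eq_of_eval_pt_eq (Nat.zero_le d) le_rfl hpt,
    hQ.rest_top hd (hΩ j) k, eval_mul, eval_C]
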